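/- Let n ≥ 2 and δ ∈ (0,1). For ε ∈ (0,1) set U_ε = B_1 \ closure(B_{1−ε}) ⊂ ℝ^{2n}. Then for every ε ∈ (0, δ] one has c_δ(U_ε) ≤ (1 − (1−δ)^{2n})^{1/n} · π, and this bound is strictly smaller than π. -/

import Mathlib

open Metric Set MeasureTheory Real Filter Topology Bornology
open scoped ContDiff ENNReal

noncomputable section

/-- `ℝ^{2n}` with the Euclidean structure. -/
abbrev R2n (n : ℕ) := EuclideanSpace ℝ (Fin (2 * n))

/-- The standard symplectic form `ω_st = Σ dx_i ∧ dy_i` on `ℝ^{2n}`,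
evaluated on a pair of (tangent) vectors. -/
def sympForm (n : ℕ) (v w : R2n n) : ℝ :=
  ∑ i : Fin n,
    (v ⟨2 * i.1, by have := i.isLt; omega⟩ * w ⟨2 * i.1 + 1, by have := i.isLt; omega⟩ -
      v ⟨2 * i.1 + 1, by have := i.isLt; omega⟩ * w ⟨2 * i.1, by have := i.isLt; omega⟩)

/-- `φ` is a symplectic embedding of the open set `N ⊆ ℝ^{2n}` into `U ⊆ ℝ^{2n}`:
a smooth injective map on `N` with image in `U` whose derivative preserves `ω_st`. -/
def IsSympEmbOn (n : ℕ) (N U : Set (R2n n)) (φ : R2n n → R2n n) : Prop :=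
  IsOpen N ∧ ContDiffOn ℝ ∞ φ N ∧ InjOn φ N ∧ MapsTo φ N U ∧
    ∀ p ∈ N, ∀ v w : R2n n,
      sympForm n (fderiv ℝ φ p v) (fderiv ℝ φ p w) = sympForm n v w

/-- A symplectic embedding of (a neighbourhood of) an arbitrary set `A ⊆ ℝ^{2n}` into `U`. -/
def SympEmbNbhd (n : ℕ) (A U : Set (R2n n)) : Prop :=
  ∃ N φ, A ⊆ N ∧ IsSympEmbOn n N U φ

/-- The spherical capacity `s(U)`. -/
def sphericalCap (n : ℕ) (U : Set (R2n n)) : ℝ≥0∞ :=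
  sSup {c : ℝ≥0∞ | ∃ r : ℝ, 0 < r ∧ c = ENNReal.ofReal (π * r ^ 2) ∧
    SympEmbNbhd n (sphere (0 : R2n n) r) U}

/-- The quadratic form defining the ellipsoid with symplectic half axes `a i`. -/
def ellQ (n : ℕ) (a : Fin n → ℝ) (z : R2n n) : ℝ :=
  ∑ i : Fin n,
    ((z ⟨2 * i.1, by have := i.isLt; omega⟩) ^ 2 +
      (z ⟨2 * i.1 + 1, by have := i.isLt; omega⟩) ^ 2) / (a i) ^ 2

/-- The open ellipsoid `E(a 0, …, a (n-1)) ⊆ ℝ^{2n}`. -/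
def ellipsoid (n : ℕ) (a : Fin n → ℝ) : Set (R2n n) := {z | ellQ n a z < 1}

/-- The boundary `∂E(a 0, …, a (n-1)) ⊆ ℝ^{2n}` of an ellipsoid. -/
def ellipsoidBdry (n : ℕ) (a : Fin n → ℝ) : Set (R2n n) := {z | ellQ n a z = 1}

/-- The ellipsoidal shell `U_ε = (1+ε)E \ closure((1-ε)E)`. -/
def ellShell (n : ℕ) (a : Fin n → ℝ) (ε : ℝ) : Set (R2n n) :=
  ellipsoid n (fun i => (1 + ε) * a i) \ closure (ellipsoid n (fun i => (1 - ε) * a i))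

/-- The `δ`-shell capacity `c_δ(U)`, defined via embeddings of the closed
shells `r A_δ = closure(B_r) \ B_{r(1-δ)}`. -/
def shellCap (n : ℕ) (δ : ℝ) (U : Set (R2n n)) : ℝ≥0∞ :=
  sSup {c : ℝ≥0∞ | ∃ r : ℝ, 0 < r ∧ c = ENNReal.ofReal (π * r ^ 2) ∧
    SympEmbNbhd n (closedBall (0 : R2n n) r \ ball 0 (r * (1 - δ))) U}

/-- The ellipsoidal capacity `e(U)`: the supremum of `π r₁²` over symplectic embeddings of
boundaries of ellipsoids with half axes `r₁ ≤ … ≤ r_n` (here `r₁ = ⨅ i, a i`). -/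
def ellipsoidalCap (n : ℕ) (U : Set (R2n n)) : ℝ≥0∞ :=
  sSup {c : ℝ≥0∞ | ∃ a : Fin n → ℝ, (∀ i, 0 < a i) ∧ Monotone a ∧
    c = ENNReal.ofReal (π * (⨅ i, a i) ^ 2) ∧ SympEmbNbhd n (ellipsoidBdry n a) U}

/-- The Gromov radius `c_B(U)`. -/
def gromovRadius (n : ℕ) (U : Set (R2n n)) : ℝ≥0∞ :=
  sSup {c : ℝ≥0∞ | ∃ r : ℝ, 0 < r ∧ c = ENNReal.ofReal (π * r ^ 2) ∧
    ∃ φ, IsSympEmbOn n (ball (0 : R2n n) r) U φ}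

theorem two_le_smoothExponent : (2 : WithTop ℕ∞) ≤ ((⊤ : ℕ∞) : WithTop ℕ∞) := by
  rw [show (2 : WithTop ℕ∞) = ((2 : ℕ∞) : WithTop ℕ∞) from rfl]
  exact WithTop.coe_le_coe.2 le_top

theorem isPreconnected_setOf_norm_mem {E : Type*} [NormedAddCommGroup E] [NormedSpace ℝ E]
    (hE : 1 < Module.rank ℝ E) {I : Set ℝ} (hI : IsPreconnected I) (hpos : ∀ t ∈ I, 0 < t) :
    IsPreconnected {x : E | ‖x‖ ∈ I} := by
  have himg : {x : E | ‖x‖ ∈ I} =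
      (fun p : ℝ × E => p.1 • p.2) '' (I ×ˢ sphere (0 : E) 1) := by
    ext x
    simp only [mem_ofPred_eq, mem_image, mem_prod, mem_sphere_iff_norm, sub_zero, Prod.exists]
    constructor
    · intro hx
      refine ⟨‖x‖, ‖x‖⁻¹ • x, ⟨hx, ?_⟩, ?_⟩
      · rw [norm_smul, norm_inv, norm_norm, inv_mul_cancel₀ (hpos _ hx).ne']
      · rw [smul_smul, mul_inv_cancel₀ (hpos _ hx).ne', one_smul]
    · rintro ⟨t, u, ⟨ht, hu⟩, rfl⟩
      rwa [norm_smul, hu, mul_one, Real.norm_of_nonneg (hpos t ht).le]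
  rw [himg]
  exact (hI.prod (isPreconnected_sphere hE 0 1)).image _ (by fun_prop)

theorem mem_of_fderiv_eq_zero_of_notMem {E : Type*} [NormedAddCommGroup E] [NormedSpace ℝ E]
    {H : E → ℝ} (hH : Differentiable ℝ H) {C O : Set E} (hC : IsClosed C) (hne : C.Nonempty)
    (hO : IsOpen O) (hCO : C ⊆ O) (h0 : ∀ y ∉ C, fderiv ℝ H y = 0) {V : Set ℝ}
    (hV : IsClosed V) (hOV : ∀ y ∈ O, y ∉ C → H y ∈ V) : ∀ y ∉ C, H y ∈ V := by
  have hT_open : IsOpen (Cᶜ ∩ H ⁻¹' Vᶜ) :=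
    hC.isOpen_compl.inter (hV.isOpen_compl.preimage hH.continuous)
  have hT_closed : IsClosed (Cᶜ ∩ H ⁻¹' Vᶜ) := by
    refine isClosed_of_closure_subset fun y hy => ?_
    by_cases hyC : y ∈ C
    · obtain ⟨z, hzO, hzC, hzV⟩ := mem_closure_iff.1 hy O hO (hCO hyC)
      exact (hzV (hOV z hzO hzC)).elim
    · refine ⟨hyC, ?_⟩
      obtain ⟨ρ, hρ, hball⟩ := Metric.isOpen_iff.1 hC.isOpen_compl y hyC
      obtain ⟨z, hz, -, hzV⟩ := mem_closure_iff.1 hy (ball y ρ) isOpen_ball (mem_ball_self hρ)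
      have hyz : H y = H z :=
        isOpen_ball.is_const_of_fderiv_eq_zero (convex_ball y ρ).isPreconnected
          hH.differentiableOn (fun w hw => h0 w (hball hw)) (mem_ball_self hρ) hz
      simpa only [mem_preimage, hyz] using hzV
  intro y hy
  by_contra hyV
  have huniv := (IsClopen.eq_univ (s := Cᶜ ∩ H ⁻¹' Vᶜ) ⟨hT_closed, hT_open⟩ ⟨y, hy, hyV⟩)
  obtain ⟨z, hz⟩ := hne
  exact (huniv.ge (mem_univ z)).1 hz

theorem exists_smooth_leftInverse {E : Type*} [NormedAddCommGroup E] [NormedSpace ℝ E]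
    [CompleteSpace E] {φ : E → E} {N : Set E} (hN : IsOpen N) (hφ : ContDiffOn ℝ ∞ φ N)
    (hinj : InjOn φ N) (hA : ∀ x ∈ N, ∃ A : E ≃L[ℝ] E, (A : E →L[ℝ] E) = fderiv ℝ φ x) :
    ∃ ψ : E → E, (∀ x ∈ N, ψ (φ x) = x) ∧ (∀ x ∈ N, ContDiffAt ℝ ∞ ψ (φ x)) ∧
      ∀ S ⊆ N, IsOpen S → IsOpen (φ '' S) := by
  rcases N.eq_empty_or_nonempty with rfl | ⟨x₀, -⟩
  · exact ⟨id, by simp, by simp, fun S hS _ => by simp [subset_empty_iff.1 hS]⟩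
  have : Nonempty E := ⟨x₀⟩
  have hψ : ∀ x ∈ N, Function.invFunOn φ N (φ x) = x := fun x hx => hinj.leftInvOn_invFunOn hx
  have key : ∀ x ∈ N, ∃ g : E → E, ContDiffAt ℝ ∞ g (φ x) ∧ g (φ x) = x ∧
      ∀ᶠ y in 𝓝 (φ x), φ (g y) = y := by
    intro x hx
    obtain ⟨A, hA⟩ := hA x hx
    have hcd : ContDiffAt ℝ ∞ φ x := hφ.contDiffAt (hN.mem_nhds hx)
    have hd : HasFDerivAt φ (A : E →L[ℝ] E) x := by
      rw [hA]; exact (hcd.differentiableAt (by simp)).hasFDerivAt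
    refine ⟨hcd.localInverse hd (by simp), hcd.to_localInverse hd (by simp), ?_, ?_⟩
    · exact hcd.localInverse_apply_image hd (by simp)
    · exact (hcd.hasStrictFDerivAt' hd (by simp)).eventually_right_inverse
  have himg : ∀ S ⊆ N, IsOpen S → IsOpen (φ '' S) := by
    intro S hSN hS
    rw [isOpen_iff_mem_nhds]
    rintro _ ⟨x, hx, rfl⟩
    obtain ⟨g, hg, hgx, hev⟩ := key x (hSN hx)
    have hgS : ∀ᶠ y in 𝓝 (φ x), g y ∈ S :=
      hg.continuousAt.eventually_mem (by rw [hgx]; exact hS.mem_nhds hx)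
    filter_upwards [hev, hgS] with y h1 h2 using ⟨g y, h2, h1⟩
  refine ⟨Function.invFunOn φ N, hψ, fun x hx => ?_, himg⟩
  obtain ⟨g, hg, hgx, hev⟩ := key x hx
  refine hg.congr_of_eventuallyEq ?_
  have hgS : ∀ᶠ y in 𝓝 (φ x), g y ∈ N :=
    hg.continuousAt.eventually_mem (by rw [hgx]; exact hN.mem_nhds hx)
  filter_upwards [hev, hgS] with y h1 h2
  conv_lhs => rw [← h1]
  exact hψ _ h2

theorem exists_primitive_comp_eq_add_const {E : Type*} [NormedAddCommGroup E] [NormedSpace ℝ E]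
    [CompleteSpace E] {φ : E → E} {S K : Set E} (hS : IsOpen S) (hSc : IsPreconnected S)
    (hφ : ContDiffOn ℝ ∞ φ S) (hinj : InjOn φ S)
    (hA : ∀ x ∈ S, ∃ A : E ≃L[ℝ] E, (A : E →L[ℝ] E) = fderiv ℝ φ x)
    (hK : IsCompact K) (hKS : K ⊆ S) {χ : E → ℝ} (hχ : ContDiff ℝ ∞ χ)
    (hχK : ∀ x ∈ S, x ∉ K → fderiv ℝ χ x = 0) :
    ∃ (H : E → ℝ) (c : ℝ), ContDiff ℝ 1 H ∧ (∀ x ∈ S, H (φ x) = χ x + c) ∧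
      ∀ y ∉ φ '' K, fderiv ℝ H y = 0 := by
  obtain ⟨ψ, hψ, hψs, himg⟩ := exists_smooth_leftInverse hS hφ hinj hA
  have hO : IsOpen (φ '' S) := himg S Subset.rfl hS
  have hC : IsClosed (φ '' K) := (hK.image_of_continuousOn (hφ.continuousOn.mono hKS)).isClosed
  set h : E → ℝ := fun y => χ (ψ y)
  have hh : ∀ y ∈ φ '' S, ContDiffAt ℝ ∞ h y := by
    rintro _ ⟨x, hx, rfl⟩
    exact hχ.contDiffAt.comp _ (hψs x hx)
  have hh0 : ∀ y ∈ φ '' S, y ∉ φ '' K → fderiv ℝ h y = 0 := by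
    rintro _ ⟨x, hx, rfl⟩ hy
    have hxK : x ∉ K := fun hxK => hy ⟨x, hxK, rfl⟩
    have hd : HasFDerivAt χ (fderiv ℝ χ (ψ (φ x))) (ψ (φ x)) :=
      (hχ.differentiable (by simp) _).hasFDerivAt
    rw [hψ x hx, hχK x hx hxK] at hd
    have := (hψ x hx).symm ▸ hd
    have h2 := HasFDerivAt.comp (φ x) this
      ((hψs x hx).differentiableAt (by simp)).hasFDerivAt
    exact h2.fderiv.trans (by simp)
  classical
  set B : E → E →L[ℝ] ℝ := fun y => if y ∈ φ '' S then fderiv ℝ h y else 0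
  have hB1 : ∀ y ∈ φ '' S, B =ᶠ[𝓝 y] fderiv ℝ h := fun y hy => by
    filter_upwards [hO.mem_nhds hy] with z hz using if_pos hz
  have hB0 : ∀ y ∉ φ '' K, B y = 0 := fun y hy => by
    by_cases hyS : y ∈ φ '' S
    · simp only [B, if_pos hyS, hh0 y hyS hy]
    · simp only [B, if_neg hyS]
  have hB2 : ∀ y ∉ φ '' K, B =ᶠ[𝓝 y] fun _ => 0 := fun y hy => by
    filter_upwards [hC.isOpen_compl.mem_nhds hy] with z hz using hB0 z hz
  have hcover : ∀ y, y ∈ φ '' S ∨ y ∉ φ '' K := fun y => by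
    by_cases hy : y ∈ φ '' K
    · exact Or.inl (image_mono hKS hy)
    · exact Or.inr hy
  have hBs : ContDiff ℝ 1 B := contDiff_iff_contDiffAt.2 fun y => by
    rcases hcover y with hy | hy
    · exact ((hh y hy).fderiv_right (m := 1) (by
        rw [one_add_one_eq_two]; exact two_le_smoothExponent)).congr_of_eventuallyEq (hB1 y hy)
    · exact contDiffAt_const.congr_of_eventuallyEq (hB2 y hy)
  have hsymm : ∀ y ∈ (univ : Set E), ∀ u v, fderiv ℝ B y u v = fderiv ℝ B y v u := by
    intro y _ u v
    rcases hcover y with hy | hy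
    · rw [(hB1 y hy).fderiv_eq]
      exact ((hh y hy).isSymmSndFDerivAt (by
        simp only [minSmoothness_of_isRCLikeNormedField]; exact two_le_smoothExponent)) u v
    · rw [(hB2 y hy).fderiv_eq]; simp
  obtain ⟨H, hH⟩ := convex_univ.exists_forall_hasFDerivAt_of_fderiv_symmetric isOpen_univ
    (hBs.differentiable (by simp)).differentiableOn hsymm
  have hH' : ∀ y, HasFDerivAt H (B y) y := fun y => hH y (mem_univ y)
  have hfd : fderiv ℝ H = B := funext fun y => (hH' y).fderiv
  have hdiffφ : ∀ x ∈ S, HasFDerivAt φ (fderiv ℝ φ x) x := fun x hx =>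
    ((hφ.contDiffAt (hS.mem_nhds hx)).differentiableAt (by simp)).hasFDerivAt
  have hdiff : ∀ x ∈ S, HasFDerivAt (fun x => H (φ x) - χ x) (0 : E →L[ℝ] ℝ) x := by
    intro x hx
    have hmem : φ x ∈ φ '' S := ⟨x, hx, rfl⟩
    have h1 := (hH' (φ x)).comp x (hdiffφ x hx)
    have h2 : HasFDerivAt h (B (φ x)) (φ x) := by
      rw [show B (φ x) = fderiv ℝ h (φ x) from if_pos hmem]
      exact ((hh _ hmem).differentiableAt (by simp)).hasFDerivAt
    have h3 := h2.comp x (hdiffφ x hx)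
    have h4 : (h ∘ φ) =ᶠ[𝓝 x] χ := by
      filter_upwards [hS.mem_nhds hx] with z hz
      simp [h, hψ z hz]
    have h5 := h1.sub (h3.congr_of_eventuallyEq h4.symm)
    rwa [sub_self] at h5
  obtain ⟨c, hc⟩ := hS.exists_is_const_of_fderiv_eq_zero hSc
    (fun x hx => (hdiff x hx).differentiableAt.differentiableWithinAt)
    (fun x hx => (hdiff x hx).fderiv)
  refine ⟨H, c, ?_, fun x hx => ?_, fun y hy => by rw [hfd, hB0 y hy]⟩
  · rw [contDiff_one_iff_fderiv]
    exact ⟨fun y => (hH' y).differentiableAt, hfd ▸ hBs.continuous⟩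
  · have := hc x hx
    linarith

theorem integral_fderiv_apply_eq_zero {E : Type*} [NormedAddCommGroup E] [NormedSpace ℝ E]
    [FiniteDimensional ℝ E] [MeasurableSpace E] [BorelSpace E] {μ : Measure E}
    [μ.IsAddHaarMeasure] {f : E → ℝ} (hf : ContDiff ℝ 1 f) (hc : HasCompactSupport f) (v : E) :
    ∫ x, fderiv ℝ f x v ∂μ = 0 := by
  have hcont : Continuous fun x => fderiv ℝ f x v :=
    (hf.continuous_fderiv (by simp)).clm_apply continuous_const
  have hsupp : HasCompactSupport fun x => fderiv ℝ f x v := hc.fderiv_apply ℝ v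
  have := integral_mul_fderiv_eq_neg_fderiv_mul_of_integrable (μ := μ) (f := fun _ => (1 : ℝ))
    (g := f) (v := v) (by simp)
    (by simpa using hcont.integrable_of_hasCompactSupport hsupp)
    (by simpa using hf.continuous.integrable_of_hasCompactSupport hc)
    (fun x _ => differentiableAt_const _) (fun x _ => hf.differentiable (by simp) x)
  simpa using this

/-- The partial derivative of `f` in the `i`-th coordinate direction. -/
def partialDeriv {m : ℕ} (i : Fin m) (f : EuclideanSpace ℝ (Fin m) → ℝ)
    (x : EuclideanSpace ℝ (Fin m)) : ℝ :=
  fderiv ℝ f x (EuclideanSpace.single i 1)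

theorem differentiable_coord {m : ℕ} (i : Fin m) :
    Differentiable ℝ fun x : EuclideanSpace ℝ (Fin m) => x i :=
  (EuclideanSpace.proj i : EuclideanSpace ℝ (Fin m) →L[ℝ] ℝ).differentiable

theorem contDiff_coord {m : ℕ} {k : WithTop ℕ∞} (i : Fin m) :
    ContDiff ℝ k fun x : EuclideanSpace ℝ (Fin m) => x i :=
  (EuclideanSpace.proj i : EuclideanSpace ℝ (Fin m) →L[ℝ] ℝ).contDiff

theorem partialDeriv_coord_mul {m : ℕ} (i j : Fin m) {f : EuclideanSpace ℝ (Fin m) → ℝ}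
    {x : EuclideanSpace ℝ (Fin m)} (hf : DifferentiableAt ℝ f x) :
    partialDeriv i (fun y => y j * f y) x = (if j = i then f x else 0) + x j * partialDeriv i f x := by
  have h1 : HasFDerivAt (fun y : EuclideanSpace ℝ (Fin m) => y j)
      (EuclideanSpace.proj j : EuclideanSpace ℝ (Fin m) →L[ℝ] ℝ) x :=
    (EuclideanSpace.proj j : EuclideanSpace ℝ (Fin m) →L[ℝ] ℝ).hasFDerivAt
  have h2 := (h1.mul hf.hasFDerivAt).fderiv
  have h3 : fderiv ℝ (fun y => y j * f y) x = _ := h2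
  rw [partialDeriv, h3]
  simp [partialDeriv, add_comm]

theorem partialDeriv_sub {m : ℕ} (i : Fin m) {f g : EuclideanSpace ℝ (Fin m) → ℝ}
    {x : EuclideanSpace ℝ (Fin m)} (hf : DifferentiableAt ℝ f x) (hg : DifferentiableAt ℝ g x) :
    partialDeriv i (fun y => f y - g y) x = partialDeriv i f x - partialDeriv i g x := by
  rw [partialDeriv, fderiv_fun_sub hf hg]; rfl

theorem integral_partialDeriv_eq_zero {m : ℕ} (i : Fin m) {f : EuclideanSpace ℝ (Fin m) → ℝ}
    (hf : ContDiff ℝ 1 f) (hc : HasCompactSupport f) : ∫ x, partialDeriv i f x = 0 :=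
  integral_fderiv_apply_eq_zero hf hc _

theorem integrable_partialDeriv {m : ℕ} (i : Fin m) {f : EuclideanSpace ℝ (Fin m) → ℝ}
    (hf : ContDiff ℝ 1 f) (hc : HasCompactSupport f) : Integrable (partialDeriv i f) :=
  ((hf.continuous_fderiv (by simp)).clm_apply continuous_const).integrable_of_hasCompactSupport
    (hc.fderiv_apply ℝ _)

theorem integral_rotation_eq_zero {m : ℕ} {a c : Fin m} (hac : a ≠ c)
    {u : EuclideanSpace ℝ (Fin m) → ℝ} (hu : ContDiff ℝ 1 u) (hc : HasCompactSupport u) :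
    Integrable (fun x => x a * partialDeriv c u x - x c * partialDeriv a u x) ∧
    ∫ x, (x a * partialDeriv c u x - x c * partialDeriv a u x) = 0 := by
  have key : ∀ i j : Fin m, i ≠ j → Integrable (fun x => x i * partialDeriv j u x) ∧
      ∫ x, x i * partialDeriv j u x = 0 := by
    intro i j hij
    have heq : (fun x => x i * partialDeriv j u x) = partialDeriv j fun x => x i * u x := by
      funext x
      rw [partialDeriv_coord_mul _ _ (hu.differentiable (by simp) x), if_neg hij, zero_add]
    have hcd : ContDiff ℝ 1 fun x : EuclideanSpace ℝ (Fin m) => x i * u x :=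
      (contDiff_coord i).mul hu
    have hcs : HasCompactSupport fun x : EuclideanSpace ℝ (Fin m) => x i * u x := hc.mul_left
    rw [heq]
    exact ⟨integrable_partialDeriv j hcd hcs, integral_partialDeriv_eq_zero j hcd hcs⟩
  obtain ⟨h1, h2⟩ := key a c hac
  obtain ⟨h3, h4⟩ := key c a hac.symm
  exact ⟨h1.sub h3, by rw [integral_sub h1 h3, h2, h4, sub_zero]⟩

/-- If the exterior derivative of the compactly supported one-form `g` is a multiple of the radial
one-form, then its components along the infinitesimal rotations have vanishing integrals: these
rotations are commutators of infinitesimal rotations, since the dimension is at least three. -/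
theorem integral_rotation_component_eq_zero {m : ℕ} {a b c : Fin m} (hab : a ≠ b) (hac : a ≠ c)
    (hbc : b ≠ c) {g κ : Fin m → EuclideanSpace ℝ (Fin m) → ℝ} (hg : ∀ i, ContDiff ℝ 1 (g i))
    (hgc : ∀ i, HasCompactSupport (g i))
    (hcurl : ∀ i j x, partialDeriv i (g j) x - partialDeriv j (g i) x = x i * κ j x - x j * κ i x) :
    ∫ x, (x a * g b x - x b * g a x) = 0 := by
  have hu : ∀ i j, ContDiff ℝ 1 fun x : EuclideanSpace ℝ (Fin m) => x i * g j x - x j * g i x :=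
    fun i j => ((contDiff_coord i).mul (hg j)).sub ((contDiff_coord j).mul (hg i))
  have hm : ∀ i j, HasCompactSupport fun x : EuclideanSpace ℝ (Fin m) => x i * g j x :=
    fun i j => (hgc j).mul_left
  have huc : ∀ i j, HasCompactSupport
      fun x : EuclideanSpace ℝ (Fin m) => x i * g j x - x j * g i x :=
    fun i j => (hm i j).comp₂_left (hm j i) (m := fun s t : ℝ => s - t) (by simp)
  obtain ⟨h1, h2⟩ := integral_rotation_eq_zero hac (hu c b) (huc c b)
  obtain ⟨h3, h4⟩ := integral_rotation_eq_zero hbc.symm (hu a c) (huc a c)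
  refine Eq.trans ?_ ((integral_sub h1 h3).trans (by rw [h2, h4, sub_zero]))
  refine integral_congr_ae (Eventually.of_forall fun x => ?_)
  have hd : ∀ i, DifferentiableAt ℝ (g i) x := fun i => (hg i).differentiable (by simp) x
  have hdm : ∀ i j, DifferentiableAt ℝ (fun y : EuclideanSpace ℝ (Fin m) => y i * g j y) x :=
    fun i j => (differentiable_coord i x).mul (hd j)
  simp only [partialDeriv_sub _ (hdm _ _) (hdm _ _), partialDeriv_coord_mul _ _ (hd _),
    if_true, if_neg hab, if_neg hac, if_neg hbc, if_neg hab.symm, if_neg hac.symm,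
    if_neg hbc.symm]
  linear_combination (-(x a * x c)) * hcurl c b x + x c ^ 2 * hcurl a b x - x c * x b * hcurl a c x

theorem partialDeriv_norm_sq_comp_mul {m : ℕ} (i : Fin m) {W : ℝ → ℝ} (hW : ContDiff ℝ 1 W)
    {f : EuclideanSpace ℝ (Fin m) → ℝ} {x : EuclideanSpace ℝ (Fin m)}
    (hf : DifferentiableAt ℝ f x) :
    partialDeriv i (fun y => W (‖y‖ ^ 2) * f y) x =
      W (‖x‖ ^ 2) * partialDeriv i f x + x i * (2 * deriv W (‖x‖ ^ 2) * f x) := by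
  have h1 : HasFDerivAt (fun y : EuclideanSpace ℝ (Fin m) => W (‖y‖ ^ 2))
      (deriv W (‖x‖ ^ 2) • (2 • innerSL ℝ x)) x :=
    ((hW.differentiable (by simp)) _).hasDerivAt.comp_hasFDerivAt x
      (hasStrictFDerivAt_norm_sq x).hasFDerivAt
  have h2 : fderiv ℝ (fun y => W (‖y‖ ^ 2) * f y) x = _ := (h1.mul hf.hasFDerivAt).fderiv
  rw [partialDeriv, h2]
  simp [partialDeriv, EuclideanSpace.inner_single_right]
  ring

theorem integral_radial_mul_rotation_component_eq_zero {m : ℕ} {a b c : Fin m} (hab : a ≠ b)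
    (hac : a ≠ c) (hbc : b ≠ c) {W : ℝ → ℝ} (hW : ContDiff ℝ 1 W)
    {β : Fin m → EuclideanSpace ℝ (Fin m) → ℝ} {S K : Set (EuclideanSpace ℝ (Fin m))}
    (hK : IsCompact K) (hKS : K ⊆ S)
    (hWK : ∀ x : EuclideanSpace ℝ (Fin m), x ∉ K → W (‖x‖ ^ 2) = 0)
    (hβ : ∀ i, ∀ x ∈ S, ContDiffAt ℝ 1 (β i) x)
    (hclosed : ∀ i j, ∀ x ∈ S, partialDeriv i (β j) x = partialDeriv j (β i) x) :
    Integrable (fun x => W (‖x‖ ^ 2) * (x a * β b x - x b * β a x)) ∧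
      ∫ x, W (‖x‖ ^ 2) * (x a * β b x - x b * β a x) = 0 := by
  classical
  set g : Fin m → EuclideanSpace ℝ (Fin m) → ℝ := fun i x => W (‖x‖ ^ 2) * β i x
  have hg0 : ∀ i, ∀ x ∉ K, g i x = 0 := fun i x hx => by simp [g, hWK x hx]
  have hgev : ∀ i, ∀ x ∉ K, g i =ᶠ[𝓝 x] fun _ => 0 := fun i x hx => by
    filter_upwards [hK.isClosed.isOpen_compl.mem_nhds hx] with y hy using hg0 i y hy
  have hg : ∀ i, ContDiff ℝ 1 (g i) := fun i => contDiff_iff_contDiffAt.2 fun x => by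
    by_cases hx : x ∈ K
    · exact (hW.comp (contDiff_norm_sq ℝ)).contDiffAt.mul (hβ i x (hKS hx))
    · exact contDiffAt_const.congr_of_eventuallyEq (hgev i x hx)
  have hgc : ∀ i, HasCompactSupport (g i) := fun i => HasCompactSupport.intro hK (hg0 i)
  have key := integral_rotation_component_eq_zero hab hac hbc hg hgc
    (κ := fun i x => if x ∈ S then 2 * deriv W (‖x‖ ^ 2) * β i x else 0) (fun i j x => by
      by_cases hx : x ∈ S
      · simp only [if_pos hx, g]
        rw [partialDeriv_norm_sq_comp_mul i hW ((hβ j x hx).differentiableAt (by simp)),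
          partialDeriv_norm_sq_comp_mul j hW ((hβ i x hx).differentiableAt (by simp)),
          hclosed i j x hx]
        ring
      · have hxK : x ∉ K := fun h => hx (hKS h)
        simp [if_neg hx, partialDeriv, (hgev _ x hxK).fderiv_eq])
  have hfun : (fun x => W (‖x‖ ^ 2) * (x a * β b x - x b * β a x)) =
      fun x => x a * g b x - x b * g a x := by
    funext x
    simp only [g]
    ring
  rw [hfun]
  refine ⟨Continuous.integrable_of_hasCompactSupport ?_ (HasCompactSupport.intro hK ?_), key⟩
  · have hc : ∀ i, Continuous (g i) := fun i => (hg i).continuous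
    have hx : ∀ i, Continuous fun x : EuclideanSpace ℝ (Fin m) => x i :=
      fun i => (differentiable_coord i).continuous
    exact ((hx a).mul (hc b)).sub ((hx b).mul (hc a))
  · intro x hx
    rw [hg0 a x hx, hg0 b x hx]
    ring

/-- The index of the coordinate `x_i`. -/
def idxX {n : ℕ} (i : Fin n) : Fin (2 * n) := ⟨2 * i.1, by have := i.isLt; omega⟩

/-- The index of the coordinate `y_i`. -/
def idxY {n : ℕ} (i : Fin n) : Fin (2 * n) := ⟨2 * i.1 + 1, by have := i.isLt; omega⟩

theorem idxX_injective {n : ℕ} : Function.Injective (idxX : Fin n → Fin (2 * n)) := fun i j h => by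
  have := congrArg Fin.val h
  simp only [idxX] at this
  exact Fin.ext (by omega)

theorem idxY_injective {n : ℕ} : Function.Injective (idxY : Fin n → Fin (2 * n)) := fun i j h => by
  have := congrArg Fin.val h
  simp only [idxY] at this
  exact Fin.ext (by omega)

theorem idxX_ne_idxY {n : ℕ} (i j : Fin n) : idxX i ≠ idxY j := fun h => by
  have := congrArg Fin.val h
  simp only [idxX, idxY] at this
  omega

theorem sum_eq_sum_idxX_add_idxY {n : ℕ} (f : Fin (2 * n) → ℝ) :
    ∑ k, f k = ∑ i : Fin n, (f (idxX i) + f (idxY i)) := by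
  have hbij : Function.Bijective (Sum.elim idxX idxY : Fin n ⊕ Fin n → Fin (2 * n)) := by
    constructor
    · rintro (i | i) (j | j) h <;> simp [idxX, idxY, Fin.ext_iff] at h ⊢ <;> omega
    · intro k
      have hk := k.isLt
      rcases Nat.even_or_odd' k.1 with ⟨c, hc | hc⟩
      · exact ⟨Sum.inl ⟨c, by omega⟩, Fin.ext hc.symm⟩
      · exact ⟨Sum.inr ⟨c, by omega⟩, Fin.ext hc.symm⟩
  rw [← Function.Bijective.sum_comp hbij f, Fintype.sum_sum_type, Finset.sum_add_distrib]
  rfl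

/-- The standard complex structure on `ℝ^{2n}`. -/
def stdJ (n : ℕ) : R2n n →L[ℝ] R2n n :=
  ∑ i : Fin n, ((EuclideanSpace.proj (idxX i) : R2n n →L[ℝ] ℝ).smulRight
      (EuclideanSpace.single (idxY i) (1 : ℝ)) -
    (EuclideanSpace.proj (idxY i) : R2n n →L[ℝ] ℝ).smulRight
      (EuclideanSpace.single (idxX i) (1 : ℝ)))

theorem stdJ_apply (n : ℕ) (v : R2n n) : stdJ n v = ∑ i : Fin n,
    (v (idxX i) • EuclideanSpace.single (idxY i) (1 : ℝ) -
      v (idxY i) • EuclideanSpace.single (idxX i) (1 : ℝ)) := by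
  simp [stdJ]

theorem sympForm_eq_inner_stdJ (n : ℕ) (v w : R2n n) :
    sympForm n v w = inner ℝ (stdJ n v) w := by
  rw [stdJ_apply, sum_inner]
  refine Finset.sum_congr rfl fun i _ => ?_
  rw [inner_sub_left, inner_smul_left, inner_smul_left, EuclideanSpace.inner_single_left,
    EuclideanSpace.inner_single_left]
  simp [idxX, idxY]

theorem sympForm_single_idxX (n : ℕ) (v : R2n n) (i : Fin n) :
    sympForm n v (EuclideanSpace.single (idxX i) 1) = -v (idxY i) := by
  have h1 : ∀ j : Fin n, (idxX j = idxX i) = (j = i) := fun j => by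
    rw [idxX_injective.eq_iff]
  have h2 : ∀ j : Fin n, (idxY j = idxX i) = False := fun j =>
    eq_false (idxX_ne_idxY i j).symm
  change ∑ j : Fin n, (v (idxX j) * (EuclideanSpace.single (idxX i) (1 : ℝ)) (idxY j) -
    v (idxY j) * (EuclideanSpace.single (idxX i) (1 : ℝ)) (idxX j)) = _
  simp [h1, h2]

theorem sympForm_single_idxY (n : ℕ) (v : R2n n) (i : Fin n) :
    sympForm n v (EuclideanSpace.single (idxY i) 1) = v (idxX i) := by
  have h1 : ∀ j : Fin n, (idxY j = idxY i) = (j = i) := fun j => by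
    rw [idxY_injective.eq_iff]
  have h2 : ∀ j : Fin n, (idxX j = idxY i) = False := fun j =>
    eq_false (idxX_ne_idxY j i)
  change ∑ j : Fin n, (v (idxX j) * (EuclideanSpace.single (idxY i) (1 : ℝ)) (idxY j) -
    v (idxY j) * (EuclideanSpace.single (idxY i) (1 : ℝ)) (idxX j)) = _
  simp [h1, h2]

theorem sympForm_stdJ_right (n : ℕ) (u x : R2n n) :
    sympForm n u (stdJ n x) = inner ℝ x u := by
  rw [sympForm_eq_inner_stdJ, stdJ_apply n x, inner_sum, PiLp.inner_apply, sum_eq_sum_idxX_add_idxY]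
  refine Finset.sum_congr rfl fun i _ => ?_
  rw [inner_sub_right, inner_smul_right, inner_smul_right, ← sympForm_eq_inner_stdJ,
    ← sympForm_eq_inner_stdJ, sympForm_single_idxX, sympForm_single_idxY]
  simp only [RCLike.inner_apply, conj_trivial]
  ring

theorem stdJ_injective (n : ℕ) : Function.Injective (stdJ n) := by
  rw [injective_iff_map_eq_zero]
  intro u hu
  rw [← inner_self_eq_zero (𝕜 := ℝ), ← sympForm_stdJ_right, hu, sympForm_eq_inner_stdJ,
    inner_zero_right]

theorem det_adjoint_eq_det {E : Type*} [NormedAddCommGroup E] [InnerProductSpace ℝ E]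
    [FiniteDimensional ℝ E] (A : E →ₗ[ℝ] E) :
    LinearMap.det (LinearMap.adjoint A) = LinearMap.det A := by
  have b := stdOrthonormalBasis ℝ E
  rw [← LinearMap.det_toMatrix b.toBasis, ← LinearMap.det_toMatrix b.toBasis A,
    LinearMap.toMatrix_adjoint b b, Matrix.det_conjTranspose, star_trivial]

theorem abs_det_eq_one_of_sympForm {n : ℕ} {A : R2n n →L[ℝ] R2n n}
    (hA : ∀ v w, sympForm n (A v) (A w) = sympForm n v w) : |A.det| = 1 := by
  have hcomp : LinearMap.adjoint (A : R2n n →ₗ[ℝ] R2n n) ∘ₗ (stdJ n : R2n n →ₗ[ℝ] R2n n) ∘ₗ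
      (A : R2n n →ₗ[ℝ] R2n n) = (stdJ n : R2n n →ₗ[ℝ] R2n n) := by
    refine LinearMap.ext fun v => ext_inner_right ℝ fun w => ?_
    have := hA v w
    simp only [sympForm_eq_inner_stdJ] at this
    simpa [LinearMap.adjoint_inner_left] using this
  have hJ : LinearMap.det (stdJ n : R2n n →ₗ[ℝ] R2n n) ≠ 0 := by
    have := LinearEquiv.isUnit_det'
      (LinearEquiv.ofInjectiveEndo (stdJ n : R2n n →ₗ[ℝ] R2n n) (stdJ_injective n))
    exact this.ne_zero
  have hdet := congrArg LinearMap.det hcomp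
  rw [LinearMap.det_comp, LinearMap.det_comp, det_adjoint_eq_det] at hdet
  have hsq : A.det * A.det = 1 := by
    refine mul_right_cancel₀ hJ ?_
    rw [one_mul]
    refine Eq.trans ?_ hdet
    change LinearMap.det _ * LinearMap.det _ * _ = _
    ring
  rw [← abs_one, ← sq_eq_sq_iff_abs_eq_abs, sq, hsq, one_pow]

theorem fderiv_apply_self_eq_sum {m : ℕ} (f : EuclideanSpace ℝ (Fin m) → ℝ)
    (x : EuclideanSpace ℝ (Fin m)) :
    fderiv ℝ f x x = ∑ i, x i * partialDeriv i f x := by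
  have hx : x = ∑ i, x i • EuclideanSpace.single i (1 : ℝ) := by
    have := (EuclideanSpace.basisFun (Fin m) ℝ).sum_repr x
    simpa using this.symm
  conv_lhs => rw [hx, ← hx]
  rw [show fderiv ℝ f x x = fderiv ℝ f x (∑ i, x i • EuclideanSpace.single i (1 : ℝ)) by
    rw [← hx], map_sum]
  simp [partialDeriv]

theorem integral_fderiv_apply_self {m : ℕ} {f : EuclideanSpace ℝ (Fin m) → ℝ}
    (hf : ContDiff ℝ 1 f) (hc : HasCompactSupport f) :
    ∫ x, fderiv ℝ f x x = -(m * ∫ x, f x) := by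
  have hterm : ∀ i : Fin m, (fun x : EuclideanSpace ℝ (Fin m) => x i * partialDeriv i f x) =
      fun x => partialDeriv i (fun y => y i * f y) x - f x := fun i => by
    funext x
    rw [partialDeriv_coord_mul _ _ (hf.differentiable (by simp) x), if_pos rfl]
    ring
  have hcd : ∀ i : Fin m, ContDiff ℝ 1 fun x : EuclideanSpace ℝ (Fin m) => x i * f x :=
    fun i => (contDiff_coord i).mul hf
  have hcs : ∀ i : Fin m, HasCompactSupport fun x : EuclideanSpace ℝ (Fin m) => x i * f x :=
    fun i => hc.mul_left
  have hfi : Integrable f := hf.continuous.integrable_of_hasCompactSupport hc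
  have hint : ∀ i : Fin m, Integrable
      (fun x : EuclideanSpace ℝ (Fin m) => x i * partialDeriv i f x) := fun i => by
    rw [hterm i]
    exact (integrable_partialDeriv i (hcd i) (hcs i)).sub hfi
  simp_rw [fderiv_apply_self_eq_sum]
  rw [integral_finsetSum _ fun i _ => hint i]
  have : ∀ i : Fin m, ∫ x, x i * partialDeriv i f x = -∫ x, f x := fun i => by
    rw [hterm i, integral_sub (integrable_partialDeriv i (hcd i) (hcs i)) hfi,
      integral_partialDeriv_eq_zero i (hcd i) (hcs i), zero_sub]
  simp [this]

theorem fderiv_norm_sq_comp {E : Type*} [NormedAddCommGroup E] [InnerProductSpace ℝ E] {k : ℝ → ℝ}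
    (hk : Differentiable ℝ k) (x u : E) :
    fderiv ℝ (fun y : E => k (‖y‖ ^ 2)) x u = 2 * deriv k (‖x‖ ^ 2) * inner ℝ x u := by
  have h1 : HasFDerivAt (fun y : E => k (‖y‖ ^ 2)) (deriv k (‖x‖ ^ 2) • (2 • innerSL ℝ x)) x :=
    (hk _).hasDerivAt.comp_hasFDerivAt x (hasStrictFDerivAt_norm_sq x).hasFDerivAt
  rw [h1.fderiv]
  simp
  ring

/-- The components of the one-form `ω(φ, dφ) - ω(x, dx)`. -/
def liouvilleDiff (n : ℕ) (φ : R2n n → R2n n) (j : Fin (2 * n)) (x : R2n n) : ℝ :=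
  inner ℝ (stdJ n (φ x)) (fderiv ℝ φ x (EuclideanSpace.single j 1)) -
    inner ℝ (stdJ n x) (EuclideanSpace.single j 1)

theorem contDiffAt_liouvilleDiff {n : ℕ} {φ : R2n n → R2n n} (j : Fin (2 * n)) {x : R2n n}
    (hφ : ContDiffAt ℝ 2 φ x) : ContDiffAt ℝ 1 (liouvilleDiff n φ j) x := by
  have h1 : ContDiffAt ℝ 1 (fun y => stdJ n (φ y)) x :=
    (stdJ n).contDiff.contDiffAt.comp x (hφ.of_le (by norm_num))
  have h2 : ContDiffAt ℝ 1 (fun y => fderiv ℝ φ y (EuclideanSpace.single j 1)) x :=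
    (hφ.fderiv_right (m := 1) (by rw [one_add_one_eq_two])).clm_apply contDiffAt_const
  have h3 : ContDiffAt ℝ 1 (fun y => stdJ n y) x := (stdJ n).contDiff.contDiffAt
  exact (h1.inner ℝ h2).sub (h3.inner ℝ contDiffAt_const)

theorem partialDeriv_liouvilleDiff {n : ℕ} {φ : R2n n → R2n n} (i j : Fin (2 * n)) {x : R2n n}
    (hφ : ContDiffAt ℝ 2 φ x)
    (hsymp : ∀ v w, sympForm n (fderiv ℝ φ x v) (fderiv ℝ φ x w) = sympForm n v w) :
    partialDeriv i (liouvilleDiff n φ j) x =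
      inner ℝ (stdJ n (φ x)) (fderiv ℝ (fderiv ℝ φ) x (EuclideanSpace.single i 1)
        (EuclideanSpace.single j 1)) := by
  have h1 : HasFDerivAt (fun y => stdJ n (φ y)) ((stdJ n).comp (fderiv ℝ φ x)) x :=
    (stdJ n).hasFDerivAt.comp x (hφ.differentiableAt (by simp)).hasFDerivAt
  have hd2 : DifferentiableAt ℝ (fderiv ℝ φ) x :=
    (hφ.fderiv_right (m := 1) (by rw [one_add_one_eq_two])).differentiableAt (by simp)
  have h2 := hd2.hasFDerivAt.clm_apply
    (hasFDerivAt_const (EuclideanSpace.single j (1 : ℝ) : R2n n) x)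
  have h3 : HasFDerivAt (fun y => stdJ n y) (stdJ n) x := (stdJ n).hasFDerivAt
  have h4 := (h1.inner ℝ h2).sub
    (h3.inner ℝ (hasFDerivAt_const (EuclideanSpace.single j (1 : ℝ) : R2n n) x))
  have h5 : fderiv ℝ (liouvilleDiff n φ j) x = _ := h4.fderiv
  have h6 := hsymp (EuclideanSpace.single i 1) (EuclideanSpace.single j 1)
  rw [sympForm_eq_inner_stdJ, sympForm_eq_inner_stdJ] at h6
  rw [partialDeriv, h5]
  simp [fderivInnerCLM_apply, h6]

theorem sympForm_fderiv_stdJ {n : ℕ} (φ : R2n n → R2n n) (x : R2n n) :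
    sympForm n (φ x) (fderiv ℝ φ x (stdJ n x)) = ‖x‖ ^ 2 +
      ∑ i : Fin n, (x (idxX i) * liouvilleDiff n φ (idxY i) x -
        x (idxY i) * liouvilleDiff n φ (idxX i) x) := by
  have h1 : inner ℝ (stdJ n x) (stdJ n x) = ‖x‖ ^ 2 := by
    rw [← sympForm_eq_inner_stdJ, sympForm_stdJ_right, real_inner_self_eq_norm_sq]
  have h2 : ∀ L : R2n n →L[ℝ] R2n n, ∀ z : R2n n, inner ℝ z (L (stdJ n x)) =
      ∑ i : Fin n, (x (idxX i) * inner ℝ z (L (EuclideanSpace.single (idxY i) 1)) -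
        x (idxY i) * inner ℝ z (L (EuclideanSpace.single (idxX i) 1))) := by
    intro L z
    rw [stdJ_apply, map_sum, inner_sum]
    simp only [map_sub, map_smul, inner_sub_right, inner_smul_right]
  have h3 := h2 (ContinuousLinearMap.id ℝ _) (stdJ n x)
  simp only [ContinuousLinearMap.id_apply] at h3
  rw [sympForm_eq_inner_stdJ, h2, ← h1, h3, ← Finset.sum_add_distrib]
  refine Finset.sum_congr rfl fun i _ => ?_
  simp only [liouvilleDiff]
  ring

theorem integral_radial_mul_sympForm {n : ℕ} (hn : 2 ≤ n) {W : ℝ → ℝ} (hW : ContDiff ℝ 1 W)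
    {φ : R2n n → R2n n} {S K : Set (R2n n)} (hK : IsCompact K) (hKS : K ⊆ S)
    (hWK : ∀ x : R2n n, x ∉ K → W (‖x‖ ^ 2) = 0) (hφ : ∀ x ∈ S, ContDiffAt ℝ 2 φ x)
    (hsymp : ∀ x ∈ S, ∀ v w, sympForm n (fderiv ℝ φ x v) (fderiv ℝ φ x w) = sympForm n v w) :
    ∫ x, W (‖x‖ ^ 2) * sympForm n (φ x) (fderiv ℝ φ x (stdJ n x)) =
      ∫ x : R2n n, W (‖x‖ ^ 2) * ‖x‖ ^ 2 := by
  have hterm : ∀ i : Fin n,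
      Integrable (fun x => W (‖x‖ ^ 2) * (x (idxX i) * liouvilleDiff n φ (idxY i) x -
        x (idxY i) * liouvilleDiff n φ (idxX i) x)) ∧
      ∫ x, W (‖x‖ ^ 2) * (x (idxX i) * liouvilleDiff n φ (idxY i) x -
        x (idxY i) * liouvilleDiff n φ (idxX i) x) = 0 := by
    intro i
    have : Nontrivial (Fin n) := Fin.nontrivial_iff_two_le.2 hn
    obtain ⟨j, hj⟩ := exists_ne i
    refine integral_radial_mul_rotation_component_eq_zero (c := idxX j) (idxX_ne_idxY i i)
      (fun h => hj (idxX_injective h).symm) (idxX_ne_idxY j i).symm hW hK hKS hWK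
      (fun k x hx => contDiffAt_liouvilleDiff k (hφ x hx)) fun k l x hx => ?_
    rw [partialDeriv_liouvilleDiff k l (hφ x hx) (hsymp x hx),
      partialDeriv_liouvilleDiff l k (hφ x hx) (hsymp x hx),
      ((hφ x hx).isSymmSndFDerivAt (by simp [minSmoothness_of_isRCLikeNormedField])).eq]
  have hint : Integrable fun x : R2n n => W (‖x‖ ^ 2) * ‖x‖ ^ 2 := by
    refine Continuous.integrable_of_hasCompactSupport ?_ (HasCompactSupport.intro hK ?_)
    · have := hW.continuous
      fun_prop
    · intro x hx
      rw [hWK x hx, zero_mul]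
  simp_rw [sympForm_fderiv_stdJ, mul_add, Finset.mul_sum]
  rw [integral_add hint (integrable_finsetSum _ fun i _ => (hterm i).1),
    integral_finsetSum _ fun i _ => (hterm i).1]
  simp [hterm]

theorem exists_continuousLinearEquiv_of_sympForm {n : ℕ} {A : R2n n →L[ℝ] R2n n}
    (hA : ∀ v w, sympForm n (A v) (A w) = sympForm n v w) :
    ∃ A' : R2n n ≃L[ℝ] R2n n, (A' : R2n n →L[ℝ] R2n n) = A := by
  have hdet : A.det ≠ 0 := fun h => by
    have := abs_det_eq_one_of_sympForm hA
    rw [h, abs_zero] at this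
    exact zero_ne_one this
  exact ⟨A.toContinuousLinearEquivOfDetNeZero hdet, by simp⟩

theorem setIntegral_image_eq_of_sympForm {n : ℕ} {φ : R2n n → R2n n} {S : Set (R2n n)}
    (hS : IsOpen S) (hφ : ∀ x ∈ S, DifferentiableAt ℝ φ x) (hinj : InjOn φ S)
    (hsymp : ∀ x ∈ S, ∀ v w, sympForm n (fderiv ℝ φ x v) (fderiv ℝ φ x w) = sympForm n v w)
    (F : R2n n → ℝ) : ∫ y in φ '' S, F y = ∫ x in S, F (φ x) := by
  rw [integral_image_eq_integral_abs_det_fderiv_smul volume hS.measurableSet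
    (fun x hx => (hφ x hx).hasFDerivAt.hasFDerivWithinAt) hinj F]
  refine setIntegral_congr_fun hS.measurableSet fun x hx => ?_
  simp only [abs_det_eq_one_of_sympForm (hsymp x hx), one_smul]

theorem integral_eq_integral_of_comp_eq_add_const {n : ℕ} (hn : 2 ≤ n) {φ : R2n n → R2n n}
    {S K : Set (R2n n)} (hS : IsOpen S) (hK : IsCompact K) (hKS : K ⊆ S)
    (hφ : ∀ x ∈ S, ContDiffAt ℝ 2 φ x) (hinj : InjOn φ S)
    (hsymp : ∀ x ∈ S, ∀ v w, sympForm n (fderiv ℝ φ x v) (fderiv ℝ φ x w) = sympForm n v w)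
    {k : ℝ → ℝ} (hk : ContDiff ℝ 2 k) (hkK : ∀ x : R2n n, x ∉ K → deriv k (‖x‖ ^ 2) = 0)
    (hkc : HasCompactSupport fun x : R2n n => k (‖x‖ ^ 2))
    {H : R2n n → ℝ} (hH : ContDiff ℝ 1 H) (hHc : HasCompactSupport H) {c : ℝ}
    (hHφ : ∀ x ∈ S, H (φ x) = k (‖x‖ ^ 2) + c) (hH0 : ∀ y ∉ φ '' K, fderiv ℝ H y = 0) :
    ∫ y, H y = ∫ x : R2n n, k (‖x‖ ^ 2) := by
  have hk1 : ContDiff ℝ 1 (deriv k) := by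
    have : ContDiff ℝ (1 + 1) k := by rwa [one_add_one_eq_two]
    exact (contDiff_succ_iff_deriv.1 this).2.2
  have hkd : Differentiable ℝ k := hk.differentiable (by simp)
  have hW : ContDiff ℝ 1 fun t => 2 * deriv k t := contDiff_const.mul hk1
  have hWK : ∀ x : R2n n, x ∉ K → 2 * deriv k (‖x‖ ^ 2) = 0 := fun x hx => by
    rw [hkK x hx, mul_zero]
  have hχ : ContDiff ℝ 1 fun x : R2n n => k (‖x‖ ^ 2) :=
    (hk.of_le (by norm_num)).comp (contDiff_norm_sq ℝ)
  have hpt : ∀ x ∈ S, fderiv ℝ H (φ x) (φ x) =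
      2 * deriv k (‖x‖ ^ 2) * sympForm n (φ x) (fderiv ℝ φ x (stdJ n x)) := by
    intro x hx
    obtain ⟨A, hA⟩ := exists_continuousLinearEquiv_of_sympForm (hsymp x hx)
    obtain ⟨u, hu⟩ : ∃ u, fderiv ℝ φ x u = φ x := by
      refine ⟨A.symm (φ x), ?_⟩
      rw [← hA]
      exact A.apply_symm_apply _
    have hcomp : HasFDerivAt (fun y => H (φ y)) ((fderiv ℝ H (φ x)).comp (fderiv ℝ φ x)) x :=
      (hH.differentiable (by simp) _).hasFDerivAt.comp x
        ((hφ x hx).differentiableAt (by simp)).hasFDerivAt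
    have hev : (fun y => H (φ y)) =ᶠ[𝓝 x] fun y => k (‖y‖ ^ 2) + c := by
      filter_upwards [hS.mem_nhds hx] with y hy using hHφ y hy
    have h1 : fderiv ℝ H (φ x) (fderiv ℝ φ x u) = 2 * deriv k (‖x‖ ^ 2) * inner ℝ x u := by
      have := hcomp.fderiv
      rw [hev.fderiv_eq, fderiv_add_const] at this
      rw [← fderiv_norm_sq_comp hkd x u, this]
      rfl
    rw [hu] at h1
    rw [h1, ← sympForm_stdJ_right, ← hsymp x hx, hu]
  have hHint : ∫ y, fderiv ℝ H y y =
      ∫ x, 2 * deriv k (‖x‖ ^ 2) * sympForm n (φ x) (fderiv ℝ φ x (stdJ n x)) := by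
    rw [← setIntegral_eq_integral_of_forall_compl_eq_zero (s := φ '' S) fun y hy => by
        rw [hH0 y fun h => hy (image_mono hKS h)]; rfl,
      setIntegral_image_eq_of_sympForm hS (fun x hx => (hφ x hx).differentiableAt (by simp)) hinj
        hsymp, setIntegral_congr_fun hS.measurableSet hpt]
    exact setIntegral_eq_integral_of_forall_compl_eq_zero fun x hx => by
      rw [hWK x fun h => hx (hKS h), zero_mul]
  have hχint : ∫ x : R2n n, fderiv ℝ (fun x : R2n n => k (‖x‖ ^ 2)) x x =
      ∫ x : R2n n, 2 * deriv k (‖x‖ ^ 2) * ‖x‖ ^ 2 := by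
    simp_rw [fderiv_norm_sq_comp hkd, real_inner_self_eq_norm_sq]
  rw [integral_radial_mul_sympForm hn hW hK hKS hWK hφ hsymp, ← hχint,
    integral_fderiv_apply_self hH hHc, integral_fderiv_apply_self hχ hkc, neg_inj] at hHint
  exact mul_left_cancel₀ (by positivity) hHint

theorem exists_radial_cutoff {s t : ℝ} (hst : s < t) :
    ∃ k : ℝ → ℝ, ContDiff ℝ ∞ k ∧ (∀ x, 0 ≤ k x ∧ k x ≤ 1) ∧ (∀ x ≤ s, k x = 1) ∧
      (∀ x, t ≤ x → k x = 0) ∧ ∀ x ∉ Icc s t, deriv k x = 0 := by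
  have h0 : 0 < t - s := sub_pos.2 hst
  have h1 : ∀ x ≤ s, smoothTransition ((t - x) / (t - s)) = 1 := fun x hx =>
    smoothTransition.one_of_one_le ((one_le_div h0).2 (by linarith))
  have h2 : ∀ x, t ≤ x → smoothTransition ((t - x) / (t - s)) = 0 := fun x hx =>
    smoothTransition.zero_of_nonpos (div_nonpos_of_nonpos_of_nonneg (by linarith) h0.le)
  refine ⟨fun x => smoothTransition ((t - x) / (t - s)), ?_, fun x =>
    ⟨smoothTransition.nonneg _, smoothTransition.le_one _⟩, h1, h2, fun x hx => ?_⟩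
  · exact smoothTransition.contDiff.comp ((contDiff_const.sub contDiff_id).div_const _)
  · rcases not_and_or.1 hx with hx | hx
    · have : (fun x => smoothTransition ((t - x) / (t - s))) =ᶠ[𝓝 x] fun _ => (1 : ℝ) := by
        filter_upwards [Iio_mem_nhds (not_le.1 hx)] with y hy using h1 y (le_of_lt hy)
      simp [this.deriv_eq]
    · have : (fun x => smoothTransition ((t - x) / (t - s))) =ᶠ[𝓝 x] fun _ => (0 : ℝ) := by
        filter_upwards [Ioi_mem_nhds (not_le.1 hx)] with y hy using h2 y (le_of_lt hy)
      simp [this.deriv_eq]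

/-- The characteristic function of the region enclosed by a symplectically embedded spherical shell
in a shell of outer radius one, smoothed in the interior of the embedded shell. -/
theorem exists_enclosed_region_cutoff {n : ℕ} (hn : 2 ≤ n) {a s t b ρ : ℝ} (ha : 0 < a)
    (has : a < s) (hst : s < t) (htb : t < b) (hρ : 0 < ρ) {φ : R2n n → R2n n}
    (hφ : ContDiffOn ℝ ∞ φ {x | ‖x‖ ∈ Ioo a b}) (hinj : InjOn φ {x | ‖x‖ ∈ Ioo a b})
    (hmaps : MapsTo φ {x | ‖x‖ ∈ Ioo a b} (ball 0 1 \ closedBall 0 ρ))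
    (hsymp : ∀ x ∈ {x : R2n n | ‖x‖ ∈ Ioo a b}, ∀ v w,
      sympForm n (fderiv ℝ φ x v) (fderiv ℝ φ x w) = sympForm n v w) :
    ∃ k : ℝ → ℝ, Continuous k ∧ (∀ x, 0 ≤ k x ∧ k x ≤ 1) ∧ (∀ x ≤ s ^ 2, k x = 1) ∧
      (∀ x, t ^ 2 ≤ x → k x = 0) ∧
      ∃ H : R2n n → ℝ, Continuous H ∧ (∀ y, 0 ≤ H y ∧ H y ≤ 1) ∧
        (∀ y, 1 ≤ ‖y‖ → H y = 0) ∧ (∀ x ∈ {x | ‖x‖ ∈ Ioo a b}, H (φ x) = k (‖x‖ ^ 2)) ∧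
        ∫ y, H y = ∫ x : R2n n, k (‖x‖ ^ 2) ∧
        ((∀ y ∈ closedBall 0 ρ, H y = 0) ∨ ∀ y ∈ closedBall 0 ρ, H y = 1) := by
  have hs : 0 < s := ha.trans has
  have ht : 0 < t := hs.trans hst
  have hrank : 1 < Module.rank ℝ (R2n n) := by
    rw [← Module.finrank_eq_rank, finrank_euclideanSpace_fin]
    exact_mod_cast (by omega : 1 < 2 * n)
  have : Nontrivial (R2n n) := (rank_pos_iff_nontrivial (R := ℝ)).1 (zero_lt_one.trans hrank)
  set S : Set (R2n n) := {x | ‖x‖ ∈ Ioo a b} with hSdef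
  set K : Set (R2n n) := {x | ‖x‖ ∈ Icc s t} with hKdef
  have hS : IsOpen S := isOpen_Ioo.preimage continuous_norm
  have hSc : IsPreconnected S :=
    isPreconnected_setOf_norm_mem hrank isPreconnected_Ioo fun x hx => ha.trans hx.1
  have hK : IsCompact K := by
    refine (isCompact_closedBall (0 : R2n n) t).of_isClosed_subset
      (isClosed_Icc.preimage continuous_norm) fun x hx => ?_
    simpa using hx.2
  have hKS : K ⊆ S := fun x hx => ⟨has.trans_le hx.1, hx.2.trans_lt htb⟩
  have hKne : K.Nonempty := by
    obtain ⟨x, hx⟩ := exists_norm_eq (R2n n) hs.le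
    exact ⟨x, by simp only [hKdef, mem_ofPred_eq, hx]; exact ⟨le_rfl, hst.le⟩⟩
  have hsq : s ^ 2 < t ^ 2 := by gcongr
  obtain ⟨k, hk, hk01, hk1, hk0, hkd⟩ := exists_radial_cutoff hsq
  have hkK : ∀ x : R2n n, x ∉ K → deriv k (‖x‖ ^ 2) = 0 := fun x hx => hkd _ fun h => hx
    ⟨le_of_sq_le_sq h.1 (norm_nonneg x), le_of_sq_le_sq h.2 ht.le⟩
  have hkS : ∀ x : R2n n, x ∉ K → k (‖x‖ ^ 2) = 1 ∨ k (‖x‖ ^ 2) = 0 := fun x hx => by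
    rcases not_and_or.1 hx with h | h
    · exact Or.inl (hk1 _ (by have := not_le.1 h; gcongr))
    · exact Or.inr (hk0 _ (by have := not_le.1 h; gcongr))
  have hχ : ContDiff ℝ ∞ fun x : R2n n => k (‖x‖ ^ 2) := hk.comp (contDiff_norm_sq ℝ)
  have hkc : HasCompactSupport fun x : R2n n => k (‖x‖ ^ 2) := by
    refine HasCompactSupport.intro (isCompact_closedBall (0 : R2n n) t) fun x hx => hk0 _ ?_
    have : t < ‖x‖ := by simpa using hx
    gcongr
  have hA : ∀ x ∈ S, ∃ A : R2n n ≃L[ℝ] R2n n, (A : R2n n →L[ℝ] R2n n) = fderiv ℝ φ x :=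
    fun x hx => exists_continuousLinearEquiv_of_sympForm (hsymp x hx)
  obtain ⟨H₀, c₀, hH₀, hH₀φ, hH₀0⟩ := exists_primitive_comp_eq_add_const hS hSc hφ hinj hA hK hKS hχ
    fun x _ hxK => by
      ext u
      rw [fderiv_norm_sq_comp (hk.differentiable (by simp)), hkK x hxK]
      simp
  have hC : IsClosed (φ '' K) := (hK.image_of_continuousOn (hφ.continuousOn.mono hKS)).isClosed
  have hO : IsOpen (φ '' S) := by
    obtain ⟨-, -, -, himg⟩ := exists_smooth_leftInverse hS hφ hinj hA
    exact himg S Subset.rfl hS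
  have hval₀ : ∀ y ∉ φ '' K, H₀ y ∈ ({c₀, 1 + c₀} : Set ℝ) := by
    refine mem_of_fderiv_eq_zero_of_notMem (hH₀.differentiable (by simp)) hC (hKne.image φ) hO
      (image_mono hKS) hH₀0 (toFinite _).isClosed ?_
    rintro _ ⟨x, hx, rfl⟩ hxK
    rw [hH₀φ x hx]
    rcases hkS x (fun h => hxK ⟨x, h, rfl⟩) with h | h <;> simp [h]
  have hconst : ∀ D : Set (R2n n), IsPreconnected D → D.Nonempty → Disjoint D (φ '' K) →
      ∃ d ∈ ({c₀, 1 + c₀} : Set ℝ), ∀ y ∈ D, H₀ y = d := by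
    rintro D hD ⟨z, hz⟩ hdisj
    have hm : MapsTo H₀ D {c₀, 1 + c₀} := fun y hy =>
      hval₀ y fun h => disjoint_left.1 hdisj hy h
    exact ⟨H₀ z, hm hz, fun y hy =>
      hD.constant_of_mapsTo (toFinite _).isDiscrete hH₀.continuous.continuousOn hm hy hz⟩
  have hKU : ∀ y ∈ φ '' K, y ∈ ball (0 : R2n n) 1 \ closedBall 0 ρ := by
    rintro _ ⟨x, hx, rfl⟩
    exact hmaps (hKS hx)
  obtain ⟨d, hd, hHd⟩ := hconst {y | ‖y‖ ∈ Ici 1}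
    (isPreconnected_setOf_norm_mem hrank isPreconnected_Ici fun x hx => zero_lt_one.trans_le hx)
    (by obtain ⟨y, hy⟩ := exists_norm_eq (R2n n) zero_le_one
        exact ⟨y, hy.ge⟩)
    (disjoint_left.2 fun y hy hyK => by
      have h1 : ‖y‖ < 1 := by simpa using (hKU y hyK).1
      exact absurd hy (not_le.2 h1))
  obtain ⟨e, he, hHe⟩ := hconst (closedBall 0 ρ) (convex_closedBall _ _).isPreconnected
    ⟨0, mem_closedBall_self hρ.le⟩ (disjoint_left.2 fun y hy hyK => (hKU y hyK).2 hy)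
  set H : R2n n → ℝ := fun y => H₀ y - d with hHdef
  have hH : ContDiff ℝ 1 H := hH₀.sub contDiff_const
  have hHout : ∀ y, 1 ≤ ‖y‖ → H y = 0 := fun y hy => by
    simp only [hHdef]; rw [hHd y hy, sub_self]
  have hHc : HasCompactSupport H :=
    HasCompactSupport.intro (isCompact_closedBall (0 : R2n n) 1) fun y hy => hHout y (by
      have : 1 < ‖y‖ := by simpa using hy
      exact this.le)
  have hHφ : ∀ x ∈ S, H (φ x) = k (‖x‖ ^ 2) + (c₀ - d) := fun x hx => by
    simp only [hHdef]; rw [hH₀φ x hx]; ring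
  have hH0 : ∀ y ∉ φ '' K, fderiv ℝ H y = 0 := fun y hy => by
    simp only [hHdef, fderiv_sub_const]; exact hH₀0 y hy
  have hint : ∫ y, H y = ∫ x : R2n n, k (‖x‖ ^ 2) :=
    integral_eq_integral_of_comp_eq_add_const hn hS hK hKS
      (fun x hx => (hφ.contDiffAt (hS.mem_nhds hx)).of_le two_le_smoothExponent) hinj hsymp
      (hk.of_le two_le_smoothExponent) hkK hkc hH hHc hHφ hH0
  have hrange : ∀ y, c₀ - d ≤ H y ∧ H y ≤ 1 + (c₀ - d) := by
    intro y
    by_cases hy : y ∈ φ '' K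
    · obtain ⟨x, hx, rfl⟩ := hy
      rw [hHφ x (hKS hx)]
      exact ⟨by linarith [(hk01 (‖x‖ ^ 2)).1], by linarith [(hk01 (‖x‖ ^ 2)).2]⟩
    · simp only [hHdef]
      rcases hval₀ y hy with h | h
      · rw [h]; constructor <;> linarith
      · rw [mem_singleton_iff.1 h]; constructor <;> linarith
  have hpos : 0 < ∫ x : R2n n, k (‖x‖ ^ 2) := by
    refine hχ.continuous.integral_pos_of_hasCompactSupport_nonneg_nonzero (x := 0) hkc
      (fun x => (hk01 _).1) ?_
    rw [hk1 _ (by simp; positivity)]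
    exact one_ne_zero
  have hcd : d = c₀ := by
    rcases hd with h | h
    · exact h
    · rw [mem_singleton_iff] at h
      have : ∫ y, H y ≤ 0 := integral_nonpos fun y => by
        have := (hrange y).2
        rw [h] at this
        simpa using this
      linarith
  subst hcd
  refine ⟨k, hk.continuous, hk01, hk1, hk0, H, hH.continuous, fun y => by simpa using hrange y,
    hHout, fun x hx => by simpa using hHφ x hx, hint, ?_⟩
  rcases he with h | h
  · exact Or.inl fun y hy => by simp only [hHdef]; rw [hHe y hy, h, sub_self]
  · rw [mem_singleton_iff] at h
    exact Or.inr fun y hy => by simp only [hHdef]; rw [hHe y hy, h]; ring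

theorem shell_embedding_volume_dichotomy {n : ℕ} (hn : 2 ≤ n) {a s t b ρ : ℝ} (ha : 0 < a)
    (has : a < s) (hst : s < t) (htb : t < b) (hρ : 0 < ρ) (hρ1 : ρ ≤ 1) {φ : R2n n → R2n n}
    (hφ : ContDiffOn ℝ ∞ φ {x | ‖x‖ ∈ Ioo a b}) (hinj : InjOn φ {x | ‖x‖ ∈ Ioo a b})
    (hmaps : MapsTo φ {x | ‖x‖ ∈ Ioo a b} (ball 0 1 \ closedBall 0 ρ))
    (hsymp : ∀ x ∈ {x : R2n n | ‖x‖ ∈ Ioo a b}, ∀ v w,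
      sympForm n (fderiv ℝ φ x v) (fderiv ℝ φ x w) = sympForm n v w) :
    s ^ (2 * n) ≤ 1 - ρ ^ (2 * n) ∨ (ρ ≤ a ∧ s ≤ 1) := by
  obtain ⟨k, hkcont, hk01, hk1, hk0, H, hHcont, hH01, hHout, hHφ, hint, hin⟩ :=
    exists_enclosed_region_cutoff hn ha has hst htb hρ hφ hinj hmaps hsymp
  have hs : 0 < s := ha.trans has
  have ht : 0 < t := hs.trans hst
  set S : Set (R2n n) := {x | ‖x‖ ∈ Ioo a b}
  have hS : IsOpen S := isOpen_Ioo.preimage continuous_norm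
  set V : ℝ := volume.real (ball (0 : R2n n) 1)
  have hV : 0 < V := ENNReal.toReal_pos (measure_ball_pos _ _ one_pos).ne' measure_ball_lt_top.ne
  have hvol : ∀ r : ℝ, 0 ≤ r → volume.real (closedBall (0 : R2n n) r) = r ^ (2 * n) * V := by
    intro r hr
    rw [Measure.addHaar_real_closedBall _ _ hr, finrank_euclideanSpace_fin]
  have hχi : Integrable fun x : R2n n => k (‖x‖ ^ 2) := by
    refine Continuous.integrable_of_hasCompactSupport (by fun_prop)
      (HasCompactSupport.intro (isCompact_closedBall (0 : R2n n) t) fun x hx => hk0 _ ?_)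
    have : t < ‖x‖ := by simpa using hx
    gcongr
  have hHi : Integrable H := hHcont.integrable_of_hasCompactSupport
    (HasCompactSupport.intro (isCompact_closedBall (0 : R2n n) 1) fun y hy => hHout y (by
      have : 1 < ‖y‖ := by simpa using hy
      exact this.le))
  have hlower : s ^ (2 * n) * V ≤ ∫ y, H y := by
    rw [hint, ← hvol s hs.le, ← integral_indicator_one isClosed_closedBall.measurableSet]
    refine integral_mono ((integrable_indicator_iff isClosed_closedBall.measurableSet).2
      (integrableOn_const (measure_closedBall_lt_top).ne)) hχi fun x => ?_
    by_cases hx : x ∈ closedBall (0 : R2n n) s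
    · have : ‖x‖ ≤ s := by simpa using hx
      simp only [indicator_of_mem hx, Pi.one_apply]
      rw [hk1 _ (by gcongr)]
    · rw [indicator_of_notMem hx]
      exact (hk01 _).1
  have hupper : ∀ D : Set (R2n n), MeasurableSet D → D ⊆ closedBall 0 1 → (∀ y ∉ D, H y = 0) →
      ∫ y, H y ≤ volume.real D := by
    intro D hD hD1 hD0
    rw [← integral_indicator_one hD]
    refine integral_mono hHi ((integrable_indicator_iff hD).2
      (integrableOn_const ((measure_mono hD1).trans_lt measure_closedBall_lt_top).ne)) fun y => ?_
    by_cases hy : y ∈ D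
    · simpa only [indicator_of_mem hy, Pi.one_apply] using (hH01 y).2
    · rw [indicator_of_notMem hy, hD0 y hy]
  have hout : ∀ y ∉ closedBall (0 : R2n n) 1, H y = 0 := fun y hy => hHout y (by
    have : 1 < ‖y‖ := by simpa using hy
    exact this.le)
  rcases hin with h0 | h1
  · left
    have hsub : closedBall (0 : R2n n) ρ ⊆ closedBall 0 1 := closedBall_subset_closedBall hρ1
    have h2 : ∫ y, H y ≤ volume.real (closedBall (0 : R2n n) 1 \ closedBall 0 ρ) := by
      refine hupper _ (isClosed_closedBall.measurableSet.diff isClosed_closedBall.measurableSet)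
        sdiff_subset fun y hy => ?_
      by_cases hy1 : y ∈ closedBall (0 : R2n n) 1
      · exact h0 y (by_contra fun hyρ => hy ⟨hy1, hyρ⟩)
      · exact hout y hy1
    rw [measureReal_sdiff hsub isClosed_closedBall.measurableSet measure_closedBall_lt_top.ne,
      hvol 1 zero_le_one, hvol ρ hρ.le] at h2
    have h3 := hlower.trans h2
    rw [one_pow, ← sub_mul] at h3
    exact le_of_mul_le_mul_right h3 hV
  · right
    constructor
    · have hO : IsOpen (φ '' S) := by
        obtain ⟨-, -, -, himg⟩ := exists_smooth_leftInverse hS hφ hinj fun x hx =>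
          exists_continuousLinearEquiv_of_sympForm (hsymp x hx)
        exact himg S Subset.rfl hS
      have hdisj : Disjoint (closedBall (0 : R2n n) ρ) (φ '' S) := by
        refine disjoint_left.2 ?_
        rintro _ hy ⟨x, hx, rfl⟩
        exact (hmaps hx).2 hy
      have h2 : ρ ^ (2 * n) * V + ∫ x in S, k (‖x‖ ^ 2) ≤ ∫ y, H y := by
        have h3 : ∫ y in φ '' S, H y = ∫ x in S, k (‖x‖ ^ 2) := by
          rw [setIntegral_image_eq_of_sympForm hS (fun x hx => (hφ.contDiffAt
            (hS.mem_nhds hx)).differentiableAt (by simp)) hinj hsymp]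
          exact setIntegral_congr_fun hS.measurableSet hHφ
        have h4 : ∫ y in closedBall 0 ρ, H y = ρ ^ (2 * n) * V := by
          rw [setIntegral_congr_fun isClosed_closedBall.measurableSet h1, setIntegral_const,
            hvol ρ hρ.le, smul_eq_mul, mul_one]
        rw [← h3, ← h4, ← setIntegral_union hdisj hO.measurableSet hHi.integrableOn
          hHi.integrableOn]
        exact setIntegral_le_integral hHi (Eventually.of_forall fun y => (hH01 y).1)
      have h3 : ∫ x in Sᶜ, k (‖x‖ ^ 2) ≤ a ^ (2 * n) * V := by
        rw [← hvol a ha.le, ← integral_indicator_one isClosed_closedBall.measurableSet,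
          ← integral_indicator hS.measurableSet.compl]
        refine integral_mono (hχi.indicator hS.measurableSet.compl)
          ((integrable_indicator_iff isClosed_closedBall.measurableSet).2
            (integrableOn_const measure_closedBall_lt_top.ne)) fun x => ?_
        by_cases hx : x ∈ closedBall (0 : R2n n) a
        · rw [indicator_of_mem hx]
          exact indicator_le_self' (fun _ _ => (hk01 _).1) x |>.trans (hk01 _).2
        · rw [indicator_of_notMem hx]
          by_cases hxS : x ∈ S
          · rw [indicator_of_notMem (notMem_compl_iff.2 hxS)]
          · have hax : a < ‖x‖ := by simpa using hx
            have hbx : t ≤ ‖x‖ := htb.le.trans (not_lt.1 fun h => hxS ⟨hax, h⟩)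
            rw [indicator_of_mem hxS, hk0 _ (by gcongr)]
      rw [hint, ← integral_add_compl hS.measurableSet hχi] at h2
      have h4 : ρ ^ (2 * n) ≤ a ^ (2 * n) := le_of_mul_le_mul_right (by linarith) hV
      exact le_of_pow_le_pow_left₀ (by omega) ha.le h4
    · have h2 := hlower.trans (hupper _ isClosed_closedBall.measurableSet Subset.rfl hout)
      rw [hvol 1 zero_le_one, one_pow] at h2
      have h3 : s ^ (2 * n) ≤ 1 := le_of_mul_le_mul_right h2 hV
      exact (pow_le_one_iff_of_nonneg hs.le (by omega)).1 h3

/-- For `ε ∈ (0, δ]` one has `c_δ(U_ε) ≤ (1 - (1-δ)^(2n))^(1/n) · π`, and this bound is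
strictly smaller than `π`. -/
theorem shell_capacity_upper_bound
    (n : ℕ) (hn : 2 ≤ n) (δ : ℝ) (hδ : δ ∈ Ioo (0 : ℝ) 1)
    (ε : ℝ) (hε : ε ∈ Ioc (0 : ℝ) δ) :
    shellCap n δ (ball (0 : R2n n) 1 \ closedBall 0 (1 - ε)) ≤
        ENNReal.ofReal (((1 - (1 - δ) ^ (2 * n)) ^ ((1 : ℝ) / (n : ℝ))) * π) ∧
      ((1 - (1 - δ) ^ (2 * n)) ^ ((1 : ℝ) / (n : ℝ))) * π < π := by
  obtain ⟨hδ0, hδ1⟩ := hδ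
  obtain ⟨hε0, hεδ⟩ := hε
  have hn0 : n ≠ 0 := by omega
  have hpos : 0 < (1 - δ) ^ (2 * n) := pow_pos (by linarith) _
  have hle : (1 - δ) ^ (2 * n) < 1 := pow_lt_one₀ (by linarith) (by linarith) (by omega)
  constructor
  · refine sSup_le ?_
    rintro _ ⟨r, hr, rfl, N, φ, hAN, hN, hφ, hinj, hmaps, hsymp⟩
    obtain ⟨η, hη, hηN⟩ := ((isCompact_closedBall (0 : R2n n) r).diff
      isOpen_ball).exists_cthickening_subset_open hN hAN
    have ha : 0 < r * (1 - δ) := mul_pos hr (by linarith)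
    have har : r * (1 - δ) < r := by nlinarith
    have hSN : {x : R2n n | ‖x‖ ∈ Ioo (r * (1 - δ)) (r + η)} ⊆ N := by
      rintro x ⟨hax, hxb⟩
      rcases le_or_gt ‖x‖ r with hxr | hxr
      · exact hAN ⟨by simpa using hxr, by simpa using hax.le⟩
      · have hx0 : 0 < ‖x‖ := hr.trans hxr
        have hnorm : ‖(r / ‖x‖) • x‖ = r := by
          rw [norm_smul, norm_div, norm_norm, Real.norm_of_nonneg hr.le,
            div_mul_cancel₀ _ hx0.ne']
        refine hηN (mem_cthickening_of_dist_le x ((r / ‖x‖) • x) η _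
          ⟨by simp [hnorm], by simpa [hnorm] using har.le⟩ ?_)
        have : x - (r / ‖x‖) • x = (1 - r / ‖x‖) • x := by rw [sub_smul, one_smul]
        rw [dist_eq_norm, this, norm_smul, Real.norm_of_nonneg
          (sub_nonneg.2 ((div_le_one hx0).2 hxr.le)), sub_mul, div_mul_cancel₀ _ hx0.ne']
        linarith
    have hdich := shell_embedding_volume_dichotomy hn ha (s := r + η / 3) (t := r + 2 * η / 3)
      (by linarith) (by linarith) (by linarith) (by linarith : 0 < 1 - ε) (by linarith)
      (hφ.mono hSN) (hinj.mono hSN) (hmaps.mono_left hSN) fun x hx => hsymp x (hSN hx)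
    have hrn : r ^ (2 * n) ≤ 1 - (1 - δ) ^ (2 * n) := by
      rcases hdich with h | ⟨h1, h2⟩
      · have h3 : r ^ (2 * n) ≤ (r + η / 3) ^ (2 * n) := by gcongr; linarith
        have h4 : (1 - δ) ^ (2 * n) ≤ (1 - ε) ^ (2 * n) := by gcongr
        linarith
      · have : r < 1 := by linarith
        nlinarith
    refine ENNReal.ofReal_le_ofReal ?_
    rw [mul_comm]
    gcongr
    rw [one_div, Real.le_rpow_inv_iff_of_pos (by positivity) (by linarith)
      (by exact_mod_cast hn0.bot_lt), Real.rpow_natCast, ← pow_mul]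
    exact hrn
  · refine mul_lt_of_lt_one_left pi_pos (Real.rpow_lt_one (by linarith) (by linarith) ?_)
    have : 0 < (n : ℝ) := by exact_mod_cast hn0.bot_lt
    positivity
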